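/- arXiv:2007.07809 — 2 statements merged into one kernel-verified Lean document; each statement's English description precedes it below -/
import Mathlib

section
/- The function ρ_t is a probability density on ℚ_p: ρ_t(x) ≥ 0 for every x ∈ ℚ_p, and ∫_{ℚ_p} ρ_t(x) dμ(x) = 1. -/
open MeasureTheory ENNReal

/-- The fundamental solution (transition density) of the `p`-adic diffusion equation for
the Vladimirov operator with exponent `b` and diffusion constant `σ`:
`ρ_t(x) = Σ_{r ∈ ℤ} (e^{−σtp^{rb}} − e^{−σtp^{(r+1)b}}) · p^r · 1_{‖x‖ ≤ p^{−r}}(x)`. -/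
noncomputable def rho (p : ℕ) [Fact p.Prime] (b σ t : ℝ) (x : ℚ_[p]) : ℝ :=
  ∑' r : ℤ,
    (Real.exp (-(σ * t * (p : ℝ) ^ ((r : ℝ) * b))) -
        Real.exp (-(σ * t * (p : ℝ) ^ (((r : ℝ) + 1) * b)))) *
      ((p : ℝ) ^ r *
        Set.indicator {y : ℚ_[p] | ‖y‖ ≤ (p : ℝ) ^ (-r)} (fun _ => (1 : ℝ)) x)

open Filter Topology in
/-- A bi-infinite telescoping sum of an antitone sequence. -/
theorem Antitone.hasSum_int_sub {a : ℤ → ℝ} (ha : Antitone a) {l m : ℝ}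
    (hbot : Tendsto a atBot (𝓝 l)) (htop : Tendsto a atTop (𝓝 m)) :
    HasSum (fun r : ℤ => a r - a (r + 1)) (l - m) := by
  have hnn : ∀ r : ℤ, 0 ≤ a r - a (r + 1) := fun r => sub_nonneg.2 (ha (by lia))
  have hpos : HasSum (fun n : ℕ => a n - a (n + 1)) (a 0 - m) := by
    rw [hasSum_iff_tendsto_nat_of_nonneg fun n => hnn n]
    have h (n : ℕ) : ∑ i ∈ Finset.range n, (a i - a (i + 1)) = a 0 - a n :=
      mod_cast Finset.sum_range_sub' (fun n : ℕ => a n) n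
    simp_rw [h]
    exact (htop.comp tendsto_natCast_atTop_atTop).const_sub _
  have hneg : HasSum (fun n : ℕ => a (-(n + 1)) - a (-(n + 1) + 1)) (l - a 0) := by
    rw [hasSum_iff_tendsto_nat_of_nonneg fun n => hnn (-(n + 1))]
    have h (n : ℕ) :
        ∑ i ∈ Finset.range n, (a (-(i + 1)) - a (-(i + 1) + 1)) = a (-n) - a 0 := by
      have := Finset.sum_range_sub (fun n : ℕ => a (-n)) n
      push_cast at this
      rw [neg_zero] at this
      rw [← this]
      refine Finset.sum_congr rfl fun i _ => ?_
      rw [show (-((i : ℤ) + 1) + 1) = -i by ring]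
    simp_rw [h]
    exact (hbot.comp (tendsto_neg_atTop_atBot.comp tendsto_natCast_atTop_atTop)).sub_const _
  convert HasSum.of_nat_of_neg_add_one (f := fun r : ℤ => a r - a (r + 1)) hpos hneg using 1
  ring

namespace Padic

variable {p : ℕ} [Fact p.Prime]

theorem measurableSet_norm_le [MeasurableSpace ℚ_[p]] [BorelSpace ℚ_[p]] (c : ℝ) :
    MeasurableSet {x : ℚ_[p] | ‖x‖ ≤ c} :=
  measurableSet_le measurable_norm measurable_const

theorem measure_norm_le_ne_top [MeasurableSpace ℚ_[p]] [BorelSpace ℚ_[p]]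
    (μ : Measure ℚ_[p]) [IsFiniteMeasureOnCompacts μ] (c : ℝ) :
    μ {x : ℚ_[p] | ‖x‖ ≤ c} ≠ ∞ := by
  have h := (isCompact_closedBall (0 : ℚ_[p]) c).measure_ne_top (μ := μ)
  rwa [show Metric.closedBall (0 : ℚ_[p]) c = {x | ‖x‖ ≤ c} by ext; simp] at h

/-- The ball of radius `p ^ (-r)` is the union of `p` translates of the next smaller ball. -/
theorem setOf_norm_le_eq_biUnion (r : ℤ) :
    {x : ℚ_[p] | ‖x‖ ≤ (p : ℝ) ^ (-r)} = ⋃ k ∈ Finset.range p,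
      (fun x => -((k : ℚ_[p]) * (p : ℚ_[p]) ^ r) + x) ⁻¹'
        {x : ℚ_[p] | ‖x‖ ≤ (p : ℝ) ^ (-(r + 1))} := by
  have hp : (0 : ℝ) < p := mod_cast (Fact.out : p.Prime).pos
  have hp' : (p : ℚ_[p]) ≠ 0 := mod_cast (Fact.out : p.Prime).ne_zero
  ext x
  simp only [Set.mem_ofPred_eq, Set.mem_iUnion, Set.mem_preimage, Finset.mem_range, exists_prop]
  constructor
  · intro hx
    have hz : ‖x * (p : ℚ_[p]) ^ (-r)‖ ≤ 1 := by
      rw [norm_mul, norm_p_zpow, neg_neg]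
      calc ‖x‖ * (p : ℝ) ^ r ≤ (p : ℝ) ^ (-r) * (p : ℝ) ^ r := by gcongr
        _ = 1 := by rw [← zpow_add₀ hp.ne']; simp
    refine ⟨_, PadicInt.zmodRepr_lt_p ⟨_, hz⟩, ?_⟩
    have h := PadicInt.norm_sub_zmodRepr_lt_one ⟨_, hz⟩
    set k := PadicInt.zmodRepr (⟨_, hz⟩ : ℤ_[p])
    rw [PadicInt.norm_def] at h
    rw [norm_le_pow_iff_norm_lt_pow_add_one,
      show -(k * (p : ℚ_[p]) ^ r) + x = (x * (p : ℚ_[p]) ^ (-r) - k) * (p : ℚ_[p]) ^ r by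
        rw [sub_mul, mul_assoc, ← zpow_add₀ hp']; simp; ring,
      norm_mul, norm_p_zpow, show -(r + 1) + 1 = -r by ring]
    exact mul_lt_of_lt_one_left (by positivity) h
  · rintro ⟨k, -, hk⟩
    rw [show x = k * (p : ℚ_[p]) ^ r + (-(k * (p : ℚ_[p]) ^ r) + x) by ring]
    refine (Padic.nonarchimedean _ _).trans (max_le ?_ (hk.trans ?_))
    · rw [norm_mul, norm_p_zpow]
      exact mul_le_of_le_one_left (by positivity) (mod_cast norm_int_le_one (k : ℤ))
    · exact zpow_le_zpow_right₀ (mod_cast (Fact.out : p.Prime).one_le) (by lia)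

theorem pairwiseDisjoint_preimage_norm_le (r : ℤ) :
    (↑(Finset.range p) : Set ℕ).PairwiseDisjoint fun k : ℕ =>
      (fun x => -((k : ℚ_[p]) * (p : ℚ_[p]) ^ r) + x) ⁻¹'
        {x : ℚ_[p] | ‖x‖ ≤ (p : ℝ) ^ (-(r + 1))} := by
  have hp : (0 : ℝ) < p := mod_cast (Fact.out : p.Prime).pos
  intro i hi j hj hij
  refine Set.disjoint_left.2 fun x hxi hxj => hij ?_
  simp only [Set.mem_preimage, Set.mem_ofPred_eq] at hxi hxj
  rw [norm_le_pow_iff_norm_lt_pow_add_one, show -(r + 1) + 1 = -r by ring] at hxi hxj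
  have h : ‖((i - j : ℤ) : ℚ_[p]) * (p : ℚ_[p]) ^ r‖ < (p : ℝ) ^ (-r) := by
    rw [show ((i - j : ℤ) : ℚ_[p]) * (p : ℚ_[p]) ^ r =
      (-(j * (p : ℚ_[p]) ^ r) + x) + -(-(i * (p : ℚ_[p]) ^ r) + x) by push_cast; ring]
    exact (Padic.nonarchimedean _ _).trans_lt (max_lt hxj (by rwa [norm_neg]))
  rw [norm_mul, norm_p_zpow, mul_lt_iff_lt_one_left (by positivity),
    norm_intCast_lt_one_iff] at h
  simp only [Finset.coe_range, Set.mem_Iio] at hi hj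
  have h0 := Int.eq_zero_of_abs_lt_dvd h (by rw [abs_lt]; lia)
  lia

theorem measureReal_norm_le_eq_mul [MeasurableSpace ℚ_[p]] [BorelSpace ℚ_[p]]
    (μ : Measure ℚ_[p]) [μ.IsAddHaarMeasure] (r : ℤ) :
    μ.real {x : ℚ_[p] | ‖x‖ ≤ (p : ℝ) ^ (-r)} =
      p * μ.real {x : ℚ_[p] | ‖x‖ ≤ (p : ℝ) ^ (-(r + 1))} := by
  have h (k : ℕ) : μ ((fun x => -((k : ℚ_[p]) * (p : ℚ_[p]) ^ r) + x) ⁻¹'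
      {x : ℚ_[p] | ‖x‖ ≤ (p : ℝ) ^ (-(r + 1))}) = μ {x : ℚ_[p] | ‖x‖ ≤ (p : ℝ) ^ (-(r + 1))} :=
    measure_preimage_add μ _ _
  rw [setOf_norm_le_eq_biUnion, measureReal_biUnion_finset (pairwiseDisjoint_preimage_norm_le r)
    (fun k _ => (measurableSet_norm_le _).preimage (measurable_const_add _))
    (fun k _ => h k ▸ measure_norm_le_ne_top μ _)]
  simp only [measureReal_def, h, Finset.sum_const, Finset.card_range, nsmul_eq_mul]

/-- The normalized Haar measure of the ball of radius `p ^ (-r)` is `p ^ (-r)`. -/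
theorem measureReal_norm_le_zpow [MeasurableSpace ℚ_[p]] [BorelSpace ℚ_[p]]
    (μ : Measure ℚ_[p]) [μ.IsAddHaarMeasure] (hμ : μ {x : ℚ_[p] | ‖x‖ ≤ 1} = 1) (r : ℤ) :
    μ.real {x : ℚ_[p] | ‖x‖ ≤ (p : ℝ) ^ (-r)} = (p : ℝ) ^ (-r) := by
  have hp : (p : ℝ) ≠ 0 := mod_cast (Fact.out : p.Prime).ne_zero
  induction r using Int.induction_on with
  | zero => simp [measureReal_def, hμ]
  | succ n ih =>
    rw [measureReal_norm_le_eq_mul] at ih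
    refine mul_left_cancel₀ hp (ih.trans ?_)
    rw [← zpow_one_add₀ hp]
    congr 1
    ring
  | pred n ih =>
    rw [measureReal_norm_le_eq_mul, sub_add_cancel, ih, neg_sub, sub_eq_add_neg, zpow_add₀ hp,
      zpow_one]

end Padic

section Coefficients

variable {c b q : ℝ}

theorem antitone_exp_neg_mul_rpow (hc : 0 ≤ c) (hb : 0 ≤ b) (hq : 1 ≤ q) :
    Antitone fun r : ℤ => Real.exp (-(c * q ^ ((r : ℝ) * b))) := by
  intro r s hrs
  have : (r : ℝ) ≤ s := mod_cast hrs
  dsimp only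
  gcongr

open Filter Topology in
theorem tendsto_exp_neg_mul_rpow_atBot (hb : 0 < b) (hq : 1 < q) :
    Tendsto (fun r : ℤ => Real.exp (-(c * q ^ ((r : ℝ) * b)))) atBot (𝓝 1) := by
  have h := (tendsto_rpow_atBot_of_base_gt_one q hq).comp
    ((tendsto_intCast_atBot_iff (R := ℝ).2 tendsto_id).atBot_mul_const hb)
  simpa [Function.comp_def] using (Real.continuous_exp.tendsto _).comp (h.const_mul c).neg

open Filter Topology in
theorem tendsto_exp_neg_mul_rpow_atTop (hc : 0 < c) (hb : 0 < b) (hq : 1 < q) :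
    Tendsto (fun r : ℤ => Real.exp (-(c * q ^ ((r : ℝ) * b)))) atTop (𝓝 0) := by
  have h := (tendsto_rpow_atTop_of_base_gt_one q hq).comp
    ((tendsto_intCast_atTop_atTop (R := ℝ)).atTop_mul_const hb)
  exact Real.tendsto_exp_neg_atTop_nhds_zero.comp (h.const_mul_atTop hc)

end Coefficients

/-- `ρ_t` is a probability density on `ℚ_p`: it is nonnegative everywhere and its
integral against the normalized Haar measure is `1`. -/
theorem stmt_5 (p : ℕ) [Fact p.Prime]
    [MeasurableSpace ℚ_[p]] [BorelSpace ℚ_[p]]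
    (μ : Measure ℚ_[p]) [μ.IsAddHaarMeasure]
    (hμ : μ {x : ℚ_[p] | ‖x‖ ≤ 1} = 1)
    (b σ t : ℝ) (hb : 0 < b) (hσ : 0 < σ) (ht : 0 < t) :
    (∀ x : ℚ_[p], 0 ≤ rho p b σ t x) ∧ ∫ x, rho p b σ t x ∂μ = 1 := by
  have hp : (1 : ℝ) < p := mod_cast (Fact.out : p.Prime).one_lt
  have hp0 : (p : ℝ) ≠ 0 := by positivity
  set a : ℤ → ℝ := fun r => Real.exp (-(σ * t * (p : ℝ) ^ ((r : ℝ) * b))) with ha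
  have hanti : Antitone a := antitone_exp_neg_mul_rpow (by positivity) hb.le hp.le
  set F : ℤ → ℚ_[p] → ℝ := fun r x => (a r - a (r + 1)) *
    ((p : ℝ) ^ r * Set.indicator {y : ℚ_[p] | ‖y‖ ≤ (p : ℝ) ^ (-r)} (fun _ => (1 : ℝ)) x) with hF
  have hrho : rho p b σ t = fun x => ∑' r, F r x := by
    ext x
    simp [rho, hF, ha]
  have hFnn (r : ℤ) (x : ℚ_[p]) : 0 ≤ F r x :=
    mul_nonneg (sub_nonneg.2 (hanti (by lia)))
      (mul_nonneg (by positivity) (Set.indicator_nonneg (fun _ _ => zero_le_one) x))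
  have hFint (r : ℤ) : Integrable (F r) μ :=
    (((integrable_indicator_iff (Padic.measurableSet_norm_le _)).2
      (integrableOn_const (Padic.measure_norm_le_ne_top μ _))).const_mul _).const_mul _
  have hFval (r : ℤ) : ∫ x, F r x ∂μ = a r - a (r + 1) := by
    rw [integral_const_mul, integral_const_mul,
      integral_indicator_const _ (Padic.measurableSet_norm_le _),
      Padic.measureReal_norm_le_zpow μ hμ, smul_eq_mul, mul_one, ← zpow_add₀ hp0]
    simp
  have hsum : HasSum (fun r : ℤ => ∫ x, F r x ∂μ) 1 := by
    simpa [hFval] using hanti.hasSum_int_sub (tendsto_exp_neg_mul_rpow_atBot hb hp)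
      (tendsto_exp_neg_mul_rpow_atTop (by positivity) hb hp)
  rw [hrho]
  refine ⟨fun x => tsum_nonneg fun r => hFnn r x, ?_⟩
  refine (hasSum_integral_of_summable_integral_norm hFint ?_).unique hsum
  simpa only [Real.norm_of_nonneg (hFnn _ _)] using hsum.summable
end

section
/- For every natural number k ≥ 1, P(N = k) < P(N = 0) · (e^{T β})^k / k!, where P(N = 0) = e^{−T β}. -/
open MeasureTheory ProbabilityTheory ENNReal

lemma Real.sum_exp_sub_one_le {ι : Type*} (s : Finset ι) {b : ι → ℝ} (hb : ∀ i, 0 ≤ b i) :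
    ∑ i ∈ s, (Real.exp (b i) - 1) ≤ Real.exp (∑ i ∈ s, b i) - 1 := by
  classical
  induction s using Finset.induction_on with
  | empty => simp
  | insert i s hi ih =>
    rw [Finset.sum_insert hi, Finset.sum_insert hi, Real.exp_add]
    have h₁ := Real.one_le_exp (hb i)
    have h₂ := Real.one_le_exp (Finset.sum_nonneg fun j (_ : j ∈ s) => hb j)
    nlinarith

lemma ENNReal.tsum_ofReal_exp_sub_one_le {ι : Type*} {b : ι → ℝ} (hb : ∀ i, 0 ≤ b i)
    (hs : Summable b) :
    ∑' i, ENNReal.ofReal (Real.exp (b i) - 1) ≤ ENNReal.ofReal (Real.exp (∑' i, b i) - 1) := by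
  rw [ENNReal.tsum_eq_iSup_sum]
  refine iSup_le fun s => ?_
  rw [← ENNReal.ofReal_sum_of_nonneg fun i _ => by simpa using hb i]
  refine ENNReal.ofReal_le_ofReal ((Real.sum_exp_sub_one_le s hb).trans ?_)
  gcongr
  exact hs.sum_le_tsum s fun i _ => hb i

section FailureCount

variable {Ω : Type*}

/-- The number of indices `i` for which the event `A i` fails. -/
noncomputable def failureCount {ι : Type*} (A : ι → Set Ω) (ω : Ω) : ℝ≥0∞ :=
  ∑' i, ((A i)ᶜ).indicator (fun _ => (1 : ℝ≥0∞)) ω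

lemma measurable_failureCount {ι : Type*} [Countable ι] {m : MeasurableSpace Ω} {A : ι → Set Ω}
    (hA : ∀ i, MeasurableSet (A i)) : Measurable (failureCount A) :=
  Measurable.tsum fun i => measurable_const.indicator (hA i).compl

lemma failureCount_eq_zero_iff {ι : Type*} {A : ι → Set Ω} {ω : Ω} :
    failureCount A ω = 0 ↔ ω ∈ ⋂ i, A i := by
  simp [failureCount]

lemma failureCount_eq_add {ι : Type*} (A : ι → Set Ω) (i : ι) (ω : Ω) :
    failureCount A ω = ((A i)ᶜ).indicator (fun _ => (1 : ℝ≥0∞)) ω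
      + failureCount (fun j : {j // j ≠ i} => A j) ω := by
  have h := ENNReal.summable.tsum_add_tsum_compl (s := ({i} : Set ι))
    (f := fun j => ((A j)ᶜ).indicator (fun _ => (1 : ℝ≥0∞)) ω) ENNReal.summable
  rw [failureCount, ← h, tsum_singleton i (fun j => ((A j)ᶜ).indicator (fun _ => (1 : ℝ≥0∞)) ω)]
  rfl

variable {ι : Type*} [Countable ι] [MeasurableSpace Ω] {P : Measure Ω} {A : ι → Set Ω}

lemma indep_generateFrom_comap_failureCount (hA : ∀ i, MeasurableSet (A i))
    (hind : iIndepSet A P) (i : ι) :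
    Indep (MeasurableSpace.generateFrom {A i})
      (MeasurableSpace.comap (failureCount fun j : {j // j ≠ i} => A j) inferInstance) P := by
  have h := hind.indep_generateFrom_of_disjoint hA {i} {i}ᶜ disjoint_compl_right
  refine indep_of_indep_of_le_right (indep_of_indep_of_le_left h ?_) ?_
  · exact MeasurableSpace.generateFrom_mono (by simp)
  · refine (measurable_failureCount fun j => ?_).comap_le
    exact MeasurableSpace.measurableSet_generateFrom ⟨j, j.2, rfl⟩

lemma measure_failureCount_inter_compl_le [IsProbabilityMeasure P]
    (hA : ∀ i, MeasurableSet (A i)) (hind : iIndepSet A P) (i : ι) {b : ℝ}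
    (hb : P (A i) = ENNReal.ofReal (Real.exp (-b))) (k : ℕ) :
    P ((A i)ᶜ ∩ {ω | failureCount A ω = (k + 1 : ℕ)})
      ≤ ENNReal.ofReal (Real.exp b - 1) * P {ω | failureCount A ω = k} := by
  have hI := Indep_iff _ _ _ |>.1 (indep_generateFrom_comap_failureCount hA hind i)
  have hAi : MeasurableSet[MeasurableSpace.generateFrom {A i}] (A i) :=
    MeasurableSpace.measurableSet_generateFrom rfl
  set M := failureCount fun j : {j // j ≠ i} => A j
  have hM : MeasurableSet[MeasurableSpace.comap M inferInstance] (M ⁻¹' {(k : ℝ≥0∞)}) :=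
    ⟨_, measurableSet_singleton _, rfl⟩
  have hfail : (A i)ᶜ ∩ {ω | failureCount A ω = (k + 1 : ℕ)} = (A i)ᶜ ∩ M ⁻¹' {(k : ℝ≥0∞)} := by
    ext ω
    simp only [Set.mem_inter_iff, Set.mem_ofPred_eq, Set.mem_preimage, Set.mem_singleton_iff]
    refine and_congr_right fun hω => ?_
    rw [failureCount_eq_add A i, Set.indicator_of_mem hω, Nat.cast_add, Nat.cast_one, add_comm]
    exact ENNReal.add_left_inj ENNReal.one_ne_top
  have hsucc : A i ∩ M ⁻¹' {(k : ℝ≥0∞)} ⊆ {ω | failureCount A ω = k} := by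
    rintro ω ⟨hω, hMω⟩
    rw [Set.mem_ofPred_eq, failureCount_eq_add A i, Set.indicator_of_notMem (by simpa using hω),
      zero_add]
    exact hMω
  have hodds : P (A i)ᶜ = ENNReal.ofReal (Real.exp b - 1) * P (A i) := by
    rw [prob_compl_eq_one_sub (hA i), hb, ← ENNReal.ofReal_one,
      ← ENNReal.ofReal_sub _ (Real.exp_nonneg _), ← ENNReal.ofReal_mul' (Real.exp_nonneg _),
      sub_mul, ← Real.exp_add]
    simp
  calc P ((A i)ᶜ ∩ {ω | failureCount A ω = (k + 1 : ℕ)})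
      = P (A i)ᶜ * P (M ⁻¹' {(k : ℝ≥0∞)}) := by rw [hfail, hI _ _ hAi.compl hM]
    _ = ENNReal.ofReal (Real.exp b - 1) * P (A i ∩ M ⁻¹' {(k : ℝ≥0∞)}) := by
        rw [hodds, mul_assoc, ← hI _ _ hAi hM]
    _ ≤ _ := by gcongr

lemma natCast_mul_measure_failureCount_eq (hA : ∀ i, MeasurableSet (A i)) (k : ℕ) :
    (k : ℝ≥0∞) * P {ω | failureCount A ω = k}
      = ∑' i, P ((A i)ᶜ ∩ {ω | failureCount A ω = k}) := by
  have hmeas : MeasurableSet {ω | failureCount A ω = k} :=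
    measurable_failureCount hA (measurableSet_singleton _)
  rw [← setLIntegral_const, ← setLIntegral_congr_fun hmeas (f := failureCount A) fun ω hω => hω]
  simp only [failureCount]
  rw [lintegral_tsum fun i => (measurable_const.indicator (hA i).compl).aemeasurable]
  refine tsum_congr fun i => ?_
  rw [lintegral_indicator_const (hA i).compl, one_mul, Measure.restrict_apply (hA i).compl]

lemma factorial_mul_measure_failureCount_le [IsProbabilityMeasure P]
    (hA : ∀ i, MeasurableSet (A i)) (hind : iIndepSet A P) {b : ι → ℝ} (hb : ∀ i, 0 ≤ b i)
    (hs : Summable b) (hprob : ∀ i, P (A i) = ENNReal.ofReal (Real.exp (-b i))) (k : ℕ) :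
    (k.factorial : ℝ≥0∞) * P {ω | failureCount A ω = k}
      ≤ ENNReal.ofReal (Real.exp (∑' i, b i) - 1) ^ k * P {ω | failureCount A ω = 0} := by
  induction k with
  | zero => simp
  | succ k ih =>
    have hstep : ((k + 1 : ℕ) : ℝ≥0∞) * P {ω | failureCount A ω = (k + 1 : ℕ)}
        ≤ ENNReal.ofReal (Real.exp (∑' i, b i) - 1) * P {ω | failureCount A ω = k} := by
      rw [natCast_mul_measure_failureCount_eq hA]
      refine (ENNReal.tsum_le_tsum fun i =>
        measure_failureCount_inter_compl_le hA hind i (hprob i) k).trans ?_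
      rw [ENNReal.tsum_mul_right]
      gcongr
      exact ENNReal.tsum_ofReal_exp_sub_one_le hb hs
    calc ((k + 1).factorial : ℝ≥0∞) * P {ω | failureCount A ω = (k + 1 : ℕ)}
        = k.factorial * (((k + 1 : ℕ) : ℝ≥0∞) * P {ω | failureCount A ω = (k + 1 : ℕ)}) := by
          rw [Nat.factorial_succ, Nat.cast_mul]; ring
      _ ≤ k.factorial * (ENNReal.ofReal (Real.exp (∑' i, b i) - 1)
            * P {ω | failureCount A ω = k}) := by gcongr
      _ = ENNReal.ofReal (Real.exp (∑' i, b i) - 1)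
            * (k.factorial * P {ω | failureCount A ω = k}) := by ring
      _ ≤ ENNReal.ofReal (Real.exp (∑' i, b i) - 1)
            * (ENNReal.ofReal (Real.exp (∑' i, b i) - 1) ^ k * P {ω | failureCount A ω = 0}) := by
          gcongr
      _ = _ := by ring

end FailureCount

lemma measure_failureCount_eq_zero {Ω : Type*} [MeasurableSpace Ω] {P : Measure Ω}
    [IsProbabilityMeasure P] {A : ℕ → Set Ω} (hA : ∀ i, MeasurableSet (A i))
    (hind : iIndepSet A P) {b : ℕ → ℝ} (hs : Summable b)
    (hprob : ∀ i, P (A i) = ENNReal.ofReal (Real.exp (-b i))) :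
    P {ω | failureCount A ω = 0} = ENNReal.ofReal (Real.exp (-∑' i, b i)) := by
  simp only [failureCount_eq_zero_iff, Set.ofPred_mem_eq]
  have hlim := tendsto_measure_iInter_atTop (μ := P) (s := fun n => ⋂ i ∈ Finset.range n, A i)
    (fun n => ((Finset.range n).measurableSet_biInter fun i _ => hA i).nullMeasurableSet)
    (fun m n hmn => Set.biInter_mono (fun i hi => Finset.range_mono hmn hi) fun _ _ => le_rfl)
    ⟨0, measure_ne_top _ _⟩
  have hset : ⋂ n, ⋂ i ∈ Finset.range n, A i = ⋂ i, A i := by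
    ext ω
    simp only [Set.mem_iInter, Finset.mem_range]
    exact ⟨fun h i => h (i + 1) i i.lt_succ_self, fun h _ i _ => h i⟩
  rw [hset] at hlim
  refine tendsto_nhds_unique hlim ?_
  have hfin : P ∘ (fun n => ⋂ i ∈ Finset.range n, A i)
      = fun n => ENNReal.ofReal (Real.exp (-∑ i ∈ Finset.range n, b i)) := by
    funext n
    rw [Function.comp_apply, hind.meas_biInter, ← Finset.sum_neg_distrib, Real.exp_sum,
      ENNReal.ofReal_prod_of_nonneg fun _ _ => Real.exp_nonneg _]
    exact Finset.prod_congr rfl fun i _ => hprob i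
  rw [hfin]
  exact ENNReal.tendsto_ofReal ((Real.continuous_exp.tendsto _).comp hs.tendsto_sum_tsum_nat.neg)

/-- For the counting variable `N = Σ_i 1_{Ω \ A_i}` of failed events among independent
events `A_i` with `P(A_i) = e^{−Tβ_i}` and `β = Σ β_i < ∞`:
`P(N = 0) = e^{−Tβ}` and, for every `k ≥ 1`, `P(N = k) < P(N = 0) · (e^{Tβ})^k / k!`. -/
theorem stmt_15 {Ω : Type*} [MeasurableSpace Ω] (P : Measure Ω) [IsProbabilityMeasure P]
    (T : ℝ) (hT : 0 < T) (β : ℕ → ℝ) (hβ : ∀ i, 0 < β i) (hsum : Summable β)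
    (A : ℕ → Set Ω) (hA : ∀ i, MeasurableSet (A i)) (hind : iIndepSet A P)
    (hprob : ∀ i, P (A i) = ENNReal.ofReal (Real.exp (-(T * β i))))
    (N : Ω → ℝ≥0∞)
    (hN : ∀ ω, N ω = ∑' i, ((A i)ᶜ).indicator (fun _ => (1 : ℝ≥0∞)) ω) :
    P {ω | N ω = 0} = ENNReal.ofReal (Real.exp (-(T * ∑' i, β i))) ∧
    ∀ k : ℕ, 1 ≤ k →
      P {ω | N ω = (k : ℝ≥0∞)}
        < P {ω | N ω = 0} *
            ENNReal.ofReal (Real.exp (T * ∑' i, β i) ^ k / (Nat.factorial k)) := by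
  obtain rfl : N = failureCount A := funext hN
  have hs : Summable fun i => T * β i := hsum.mul_left T
  have hzero := measure_failureCount_eq_zero hA hind hs hprob
  rw [← tsum_mul_left]
  refine ⟨hzero, fun k hk => ?_⟩
  set E := Real.exp (∑' i, T * β i)
  have hE : 1 ≤ E := Real.one_le_exp (tsum_nonneg fun i => (mul_pos hT (hβ i)).le)
  have hfact : (0 : ℝ) < k.factorial := by exact_mod_cast k.factorial_pos
  have hle := factorial_mul_measure_failureCount_le hA hind (fun i => (mul_pos hT (hβ i)).le)
    hs hprob k
  have hne : P {ω | failureCount A ω = 0} ≠ 0 := by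
    rw [hzero]
    simp [Real.exp_pos]
  rw [ENNReal.ofReal_div_of_pos hfact, ENNReal.ofReal_natCast, ← mul_div_assoc,
    ENNReal.lt_div_iff_mul_lt (by simp [k.factorial_ne_zero]) (by simp), mul_comm]
  refine hle.trans_lt ?_
  rw [mul_comm, ← ENNReal.ofReal_pow (sub_nonneg.2 hE)]
  refine (ENNReal.mul_lt_mul_iff_right hne (measure_ne_top _ _)).2 ?_
  refine (ENNReal.ofReal_lt_ofReal_iff (by positivity)).2 ?_
  exact pow_lt_pow_left₀ (sub_one_lt E) (sub_nonneg.2 hE) (by lia)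
end
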